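/- arXiv:1703.01049 — 3 statements merged into one kernel-verified Lean document; each statement's English description precedes it below -/
import Mathlib

section
/- Let α > 0 and σ_obs > 0 be real numbers, and define σ_true = -1/(2 α σ_obs) + √(1/(4 α² σ_obs²) + 1/α). Then 0 < σ_true and α σ_true² < 1; that is, the recovered singular value is strictly positive and satisfies the spectral-radius constraint of the model. -/
/-- The deconvolved singular value `σ_true = -1/(2ασ_obs) + √(1/(4α²σ_obs²) + 1/α)`
is strictly positive and satisfies the spectral-radius constraint `α σ_true² < 1`. -/
theorem deconvolved_singular_value_pos_and_feasible (α σobs : ℝ)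
    (hα : 0 < α) (hσ : 0 < σobs) (σtrue : ℝ)
    (hdef : σtrue = -1 / (2 * α * σobs) +
      Real.sqrt (1 / (4 * α ^ 2 * σobs ^ 2) + 1 / α)) :
    0 < σtrue ∧ α * σtrue ^ 2 < 1 := by
  obtain ⟨b, hb⟩ : ∃ b, b = 1 / (2 * α * σobs) := ⟨_, rfl⟩
  have hb_pos : 0 < b := by rw [hb]; positivity
  have hb_sq : 1 / (4 * α ^ 2 * σobs ^ 2) = b ^ 2 := by rw [hb]; field_simp; norm_num
  have hα_inv : 0 < 1 / α := by positivity
  rw [hb_sq, neg_div, ← hb] at hdef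
  have hlt : b < Real.sqrt (b ^ 2 + 1 / α) := Real.lt_sqrt_of_sq_lt (by linarith)
  have hpos : 0 < σtrue := by linarith
  have hsq : (σtrue + b) ^ 2 = b ^ 2 + 1 / α := by
    rw [hdef, neg_add_eq_sub, sub_add_cancel, Real.sq_sqrt (by positivity)]
  have hquad : α * σtrue ^ 2 + 2 * (α * b * σtrue) = 1 := by
    calc α * σtrue ^ 2 + 2 * (α * b * σtrue) = α * ((σtrue + b) ^ 2 - b ^ 2) := by ring
      _ = 1 := by rw [hsq, add_sub_cancel_left, mul_one_div_cancel hα.ne']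
  have hcross : 0 < α * b * σtrue := by positivity
  exact ⟨hpos, by linarith⟩
end

section
/- Let σ_obs > 0 be fixed. Then the map α ↦ -1/(2 α σ_obs) + √(1/(4 α² σ_obs²) + 1/α) is strictly monotone decreasing on (0, ∞): a larger assumed feedback parameter α attributes more of each observed singular value to the recommender and recovers a smaller true singular value. -/
/-- The deconvolved singular value is a positive root of `σ * α * x ^ 2 + x = σ`. -/
theorem deconvolved_singular_value_pos_root {σ α : ℝ} (hσ : 0 < σ) (hα : 0 < α) :
    ∃ x : ℝ, -1 / (2 * α * σ) + Real.sqrt (1 / (4 * α ^ 2 * σ ^ 2) + 1 / α) = x ∧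
      0 < x ∧ σ * α * x ^ 2 + x = σ := by
  refine ⟨_, rfl, ?_, ?_⟩
  · have h : 1 / (2 * α * σ) < Real.sqrt (1 / (4 * α ^ 2 * σ ^ 2) + 1 / α) := by
      apply Real.lt_sqrt_of_sq_lt
      have h₁ : (1 / (2 * α * σ)) ^ 2 = 1 / (4 * α ^ 2 * σ ^ 2) := by ring
      have h₂ : 0 < 1 / α := by positivity
      linarith
    rw [neg_div]
    linarith
  · have h : Real.sqrt (1 / (4 * α ^ 2 * σ ^ 2) + 1 / α) ^ 2 =
        1 / (4 * α ^ 2 * σ ^ 2) + 1 / α := Real.sq_sqrt (by positivity)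
    rw [add_sq, h]
    field_simp
    ring

/-- For a fixed observed singular value `σ_obs > 0`, the deconvolution formula
`α ↦ -1/(2ασ_obs) + √(1/(4α²σ_obs²) + 1/α)` is strictly monotone decreasing
in the feedback parameter `α` on `(0, ∞)`. -/
theorem deconvolved_singular_value_strictAntiOn_alpha (σobs : ℝ) (hσ : 0 < σobs) :
    StrictAntiOn
      (fun α : ℝ => -1 / (2 * α * σobs) +
        Real.sqrt (1 / (4 * α ^ 2 * σobs ^ 2) + 1 / α))
      (Set.Ioi 0) := by
  intro a ha b hb hab
  obtain ⟨x, hx, hx0, hxa⟩ := deconvolved_singular_value_pos_root hσ (Set.mem_Ioi.mp ha)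
  obtain ⟨y, hy, hy0, hyb⟩ := deconvolved_singular_value_pos_root hσ (Set.mem_Ioi.mp hb)
  simp only [hx, hy]
  by_contra! hxy
  have hb0 : 0 < b := hb
  have h₁ : σobs * a * x ^ 2 < σobs * b * x ^ 2 := by gcongr
  have h₂ : σobs * b * x ^ 2 ≤ σobs * b * y ^ 2 := by gcongr
  linarith
end

section
/- Let α > 0 and σ_obs > 0, and set σ_true = -1/(2 α σ_obs) + √(1/(4 α² σ_obs²) + 1/α). Then σ_true < 1/√α; moreover σ_true → 1/√α as σ_obs → ∞. That is, the recovered true singular values are uniformly bounded by 1/√α regardless of how large the observed singular values are, and this bound is sharp. -/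
/-- The recovered singular values are uniformly bounded by `1/√α`, and this
bound is sharp: `σ_true(σ_obs) < 1/√α` for every `σ_obs > 0`, and
`σ_true(σ_obs) → 1/√α` as `σ_obs → ∞`. -/
theorem deconvolved_singular_value_bounded_sharp (α : ℝ) (hα : 0 < α) :
    (∀ σobs : ℝ, 0 < σobs →
      -1 / (2 * α * σobs) + Real.sqrt (1 / (4 * α ^ 2 * σobs ^ 2) + 1 / α) <
        1 / Real.sqrt α) ∧
    Filter.Tendsto
      (fun σobs : ℝ => -1 / (2 * α * σobs) +
        Real.sqrt (1 / (4 * α ^ 2 * σobs ^ 2) + 1 / α))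
      Filter.atTop (nhds (1 / Real.sqrt α)) := by
  have hrw : ∀ σobs : ℝ,
      -1 / (2 * α * σobs) + Real.sqrt (1 / (4 * α ^ 2 * σobs ^ 2) + 1 / α) =
        -(2 * α * σobs)⁻¹ + Real.sqrt ((2 * α * σobs)⁻¹ ^ 2 + 1 / α) := by
    intro σobs
    rw [neg_div, one_div, inv_pow, one_div (4 * α ^ 2 * σobs ^ 2)]
    ring_nf
  have hsqrt : Real.sqrt (1 / α) = 1 / Real.sqrt α := by
    rw [one_div, Real.sqrt_inv, one_div]
  simp only [hrw, ← hsqrt]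
  refine ⟨fun σobs hσ => ?_, ?_⟩
  · have ht : 0 < (2 * α * σobs)⁻¹ := by positivity
    have hs : 0 < Real.sqrt (1 / α) := Real.sqrt_pos.mpr (by positivity)
    have hsq : Real.sqrt (1 / α) ^ 2 = 1 / α := Real.sq_sqrt (by positivity)
    rw [neg_add_lt_iff_lt_add, Real.sqrt_lt' (by positivity)]
    nlinarith [mul_pos ht hs]
  · have ht : Filter.Tendsto (fun σobs : ℝ => (2 * α * σobs)⁻¹) Filter.atTop (nhds 0) :=
      (Filter.tendsto_id.const_mul_atTop (by positivity : 0 < 2 * α)).inv_tendsto_atTop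
    simpa using ht.neg.add ((ht.pow 2).add_const (1 / α)).sqrt
end
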